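/- Let d ≥ 2, N = d², λ = d³ − 3d² + 2d, and let P be the N×d matrix with P_{j,k} = ((j+k−2) mod N) + 1. Then the maximum ranking distance of the two-layer MLP family S_MLP on P satisfies MRD(S_MLP, P) ≥ sqrt( ( (N−d)³ − (N−d) − λ ) / 12 ). -/

import Mathlib

noncomputable section

/-- The alignment matrix `P` with `N = d²` rows: the `(j,k)` entry (0-based indices)
is `((j + k) % N) + 1`, i.e. `((j + k − 2) mod N) + 1` for 1-based indices. -/
def Pmat (d : ℕ) (j : Fin (d ^ 2)) (k : Fin d) : ℝ :=
  ((((j : ℕ) + (k : ℕ)) % d ^ 2 + 1 : ℕ) : ℝ)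

/-- The two-layer MLP scoring family `S_MLP = { x ↦ ⟨w₂, ReLU(W₁x)⟩ }`. -/
def SMLP (d : ℕ) : Set ((Fin d → ℝ) → ℝ) :=
  {s | ∃ (W₁ : Matrix (Fin d) (Fin d) ℝ) (w₂ : Fin d → ℝ),
    s = fun x => ∑ i, w₂ i * max (∑ k, W₁ i k * x k) 0}

/-- Maximum ranking distance of a family `S` of scoring functions on the rows of `P`. -/
def MRD {d : ℕ} (S : Set ((Fin d → ℝ) → ℝ)) : ℝ :=
  ⨆ π : Equiv.Perm (Fin (d ^ 2)),
    ⨅ s : S,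
      Real.sqrt (∑ j : Fin (d ^ 2),
        (s.1 (fun k => Pmat d j k) - (((π.symm j : ℕ) : ℝ) + 1)) ^ 2)

/-- A list of indices along which `g` strictly zigzags, the first step having the sign of `η`. -/
def IsZigzag (g : ℕ → ℝ) : ℝ → List ℕ → Prop
  | _, [] => True
  | _, [_] => True
  | η, a :: b :: l => a < b ∧ 0 < η * (g b - g a) ∧ IsZigzag g (-η) (b :: l)

/-- The forward difference of the ramp `t ↦ max (a t + b) 0` on the integers. -/
def rampDiff (a b : ℝ) (t : ℕ) : ℝ := max (a * ((t : ℝ) + 1) + b) 0 - max (a * t + b) 0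

lemma rampDiff_mono (a b : ℝ) : Monotone (rampDiff a b) := by
  refine monotone_nat_of_le_succ fun t => ?_
  simp only [rampDiff]
  push_cast
  rcases max_cases (a * ((t : ℝ) + 1) + b) 0 with h1 | h1 <;>
  rcases max_cases (a * (t : ℝ) + b) 0 with h2 | h2 <;>
  rcases max_cases (a * ((t : ℝ) + 1 + 1) + b) 0 with h3 | h3 <;>
  rw [h1.1, h2.1, h3.1] <;> nlinarith

lemma rampDiff_transition_unique {a b : ℝ} {s p q u : ℕ} (hsp : s < p) (hpq : p < q) (hqu : q < u)
    (h1 : rampDiff a b s < rampDiff a b p) (h2 : rampDiff a b q < rampDiff a b u) : False := by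
  have cs : (s : ℝ) + 1 ≤ p := by exact_mod_cast hsp
  have cp : (p : ℝ) + 1 ≤ q := by exact_mod_cast hpq
  have cq : (q : ℝ) + 1 ≤ u := by exact_mod_cast hqu
  simp only [rampDiff] at h1 h2
  rcases lt_trichotomy a 0 with ha | ha | ha
  · have hp : a * ((p : ℝ) + 1) + b < 0 := by
      by_contra! hc
      rw [max_eq_left hc, max_eq_left (by nlinarith), max_eq_left (by nlinarith),
        max_eq_left (by nlinarith)] at h1
      nlinarith
    rw [max_eq_right (by nlinarith), max_eq_right (by nlinarith), max_eq_right (by nlinarith),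
      max_eq_right (by nlinarith)] at h2
    exact lt_irrefl _ h2
  · subst ha; simp at h1
  · have hp : 0 < a * ((p : ℝ) + 1) + b := by
      by_contra! hc
      rw [max_eq_right hc, max_eq_right (by nlinarith), max_eq_right (by nlinarith),
        max_eq_right (by nlinarith)] at h1
      exact lt_irrefl _ h1
    rw [max_eq_left (by nlinarith), max_eq_left (by nlinarith), max_eq_left (by nlinarith),
      max_eq_left (by nlinarith)] at h2
    nlinarith

/-- Each step of a zigzag of `∑ i, w i * rampDiff (a i) (b i)` uses up its own ramp. -/
lemma IsZigzag.exists_ramps {d : ℕ} {w a b : Fin d → ℝ} {g : ℕ → ℝ}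
    (hg : ∀ t, g t = ∑ i, w i * rampDiff (a i) (b i) t) (l : List ℕ) :
    ∀ (η : ℝ) (t₀ : ℕ), IsZigzag g η (t₀ :: l) →
      ∃ K : List (Fin d), K.Nodup ∧ K.length = l.length ∧
        ∀ k ∈ K, ∃ q u, t₀ ≤ q ∧ q < u ∧ rampDiff (a k) (b k) q < rampDiff (a k) (b k) u ∧
          (t₀ < q ∨ 0 < η * w k) := by
  induction l with
  | nil => exact fun _ _ _ => ⟨[], by simp, rfl, by simp⟩
  | cons t₁ l ih =>
    intro η t₀ h
    obtain ⟨hlt, hpos, htail⟩ := h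
    obtain ⟨K, hK, hlen, hprop⟩ := ih (-η) t₁ htail
    have hsum : 0 < ∑ i, η * w i * (rampDiff (a i) (b i) t₁ - rampDiff (a i) (b i) t₀) := by
      have : ∑ i, η * w i * (rampDiff (a i) (b i) t₁ - rampDiff (a i) (b i) t₀)
          = η * (g t₁ - g t₀) := by
        rw [hg, hg, ← Finset.sum_sub_distrib, Finset.mul_sum]
        exact Finset.sum_congr rfl fun i _ => by ring
      rwa [this]
    obtain ⟨k₀, -, hk₀⟩ := Finset.exists_lt_of_sum_lt (s := Finset.univ) (f := fun _ => (0 : ℝ))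
      (by simpa using hsum)
    have hm := rampDiff_mono (a k₀) (b k₀) hlt.le
    have hr : rampDiff (a k₀) (b k₀) t₀ < rampDiff (a k₀) (b k₀) t₁ := by
      rcases hm.lt_or_eq with h | h
      · exact h
      · rw [h] at hk₀; simp at hk₀
    have hw : 0 < η * w k₀ := by
      by_contra! hc
      nlinarith
    refine ⟨k₀ :: K, List.nodup_cons.2 ⟨fun hmem => ?_, hK⟩, by simp [hlen], ?_⟩
    · obtain ⟨q, u, -, hqu, hru, hq⟩ := hprop k₀ hmem
      rcases hq with hq | hq
      · exact rampDiff_transition_unique hlt hq hqu hr hru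
      · linarith
    · intro k hk
      rcases List.mem_cons.1 hk with rfl | hk
      · exact ⟨t₀, t₁, le_rfl, hlt, hr, Or.inr hw⟩
      · obtain ⟨q, u, hq, hqu, hru, -⟩ := hprop k hk
        exact ⟨q, u, by omega, hqu, hru, Or.inl (by omega)⟩

lemma IsZigzag.length_le {d : ℕ} (w a b : Fin d → ℝ) {η : ℝ} {l : List ℕ}
    (h : IsZigzag (fun t => ∑ i, w i * rampDiff (a i) (b i) t) η l) : l.length ≤ d + 1 := by
  cases l with
  | nil => simp
  | cons t₀ l =>
    obtain ⟨K, hK, hlen, -⟩ := h.exists_ramps (fun _ => rfl)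
    have := hK.length_le_card
    simp at this
    simp
    omega

/-- If `h` does not follow the step `t → t + 1` of the alternating sequence `(-1) ^ t * A t`,
then almost nothing of that pair of values is captured. -/
lemma pair_error {h A : ℕ → ℝ} {t : ℕ} (hA0 : 0 ≤ A t) (hA1 : 0 ≤ A (t + 1))
    (hstep : |A (t + 1) - A t| ≤ 1) (hv : 0 ≤ (-1 : ℝ) ^ t * (h (t + 1) - h t)) :
    A t ^ 2 + A (t + 1) ^ 2 - 1 / 2
      ≤ (h t - (-1) ^ t * A t) ^ 2 + (h (t + 1) - (-1) ^ (t + 1) * A (t + 1)) ^ 2 := by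
  obtain ⟨h1, h2⟩ := abs_le.1 hstep
  rw [pow_succ (-1 : ℝ) t]
  rcases neg_one_pow_eq_or ℝ t with hs | hs <;> rw [hs] at hv ⊢ <;>
  nlinarith [sq_nonneg ((h t - A t) + (h (t + 1) + A (t + 1))),
    sq_nonneg ((h t + A t) + (h (t + 1) - A (t + 1)))]

lemma sq_add_sq_add_sq_le {x y z Y : ℝ} (hy : 0 ≤ y) (h1 : |y - x| ≤ 1) (h2 : |z - y| ≤ 1)
    (hconc : x + z ≤ 2 * y) (hY : y ≤ Y) :
    x ^ 2 + y ^ 2 + z ^ 2 - (Y ^ 2 / 3 + 2) ≤ (x + 2 * y + z) ^ 2 / 6 := by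
  obtain ⟨p, rfl⟩ : ∃ p, x = y + p := ⟨x - y, by ring⟩
  obtain ⟨q, rfl⟩ : ∃ q, z = y + q := ⟨z - y, by ring⟩
  have hp : p ^ 2 ≤ 1 := by
    rw [sq_le_one_iff_abs_le_one, ← abs_neg]; simpa using h1
  have hq : q ^ 2 ≤ 1 := by
    rw [sq_le_one_iff_abs_le_one]; simpa using h2
  have hYy : y ^ 2 ≤ Y ^ 2 := by gcongr
  nlinarith [mul_nonneg hy (show 0 ≤ -(p + q) by linarith), sq_nonneg (p + q)]

/-- If `h` does not follow the turn at `t + 1` of the alternating sequence `(-1) ^ t * A t`, then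
at most two thirds of the squared height at the middle of the triple is captured. -/
lemma triple_error {h A : ℕ → ℝ} {Y : ℝ} {t : ℕ} (a0 : 0 ≤ A t) (a1 : 0 ≤ A (t + 1))
    (a2 : 0 ≤ A (t + 2)) (h1 : |A (t + 1) - A t| ≤ 1) (h2 : |A (t + 2) - A (t + 1)| ≤ 1)
    (hconc : A t + A (t + 2) ≤ 2 * A (t + 1)) (hY : A (t + 1) ≤ Y)
    (hv : (-1 : ℝ) ^ t * ((h (t + 2) - h (t + 1)) - (h (t + 1) - h t)) ≤ 0) :
    A t ^ 2 + A (t + 1) ^ 2 + A (t + 2) ^ 2 - (Y ^ 2 / 3 + 2)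
      ≤ (h t - (-1) ^ t * A t) ^ 2 + (h (t + 1) - (-1) ^ (t + 1) * A (t + 1)) ^ 2
        + (h (t + 2) - (-1) ^ (t + 2) * A (t + 2)) ^ 2 := by
  refine (sq_add_sq_add_sq_le a1 h1 h2 hconc hY).trans ?_
  have key : ∀ e₀ e₁ e₂ S : ℝ, 0 ≤ S → S ≤ |e₀ - 2 * e₁ + e₂| →
      S ^ 2 / 6 ≤ e₀ ^ 2 + e₁ ^ 2 + e₂ ^ 2 := by
    intro e₀ e₁ e₂ S hS hle
    have : S ^ 2 ≤ (e₀ - 2 * e₁ + e₂) ^ 2 := by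
      rw [← sq_abs (e₀ - 2 * e₁ + e₂)]; gcongr
    nlinarith [sq_nonneg (2 * e₀ + e₁), sq_nonneg (e₀ - e₂), sq_nonneg (2 * e₂ + e₁)]
  refine key _ _ _ _ (by linarith) ?_
  rw [pow_succ (-1 : ℝ) t, pow_add (-1 : ℝ) t 2]
  rcases neg_one_pow_eq_or ℝ t with hs | hs <;> rw [hs] at hv ⊢
  · exact le_trans (by linarith) (neg_le_abs _)
  · exact le_trans (by linarith) (le_abs_self _)

section Alternating

variable {h A : ℕ → ℝ}

local notation "stepOf" => fun t => h (t + 1) - h t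
local notation "errSq" => fun t : ℕ => (h t - (-1 : ℝ) ^ t * A t) ^ 2

lemma sum_Ico_two_add {F : ℕ → ℝ} {a n : ℕ} (hn : a + 2 ≤ n) :
    ∑ t ∈ Finset.Ico a n, F t = F a + F (a + 1) + ∑ t ∈ Finset.Ico (a + 2) n, F t := by
  rw [Finset.sum_eq_sum_Ico_succ_bot (by omega), Finset.sum_eq_sum_Ico_succ_bot (by omega)]
  ring

/-- Greedy matching of violated steps from position `a` on; the list `L` collects the positions
left unmatched. -/
lemma exists_greedy_matching {n : ℕ} (hA : ∀ t ≤ n, 0 ≤ A t)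
    (hstep : ∀ t, |A (t + 1) - A t| ≤ 1) :
    ∀ (m a : ℕ), n + 1 = a + m →
      ∃ L : List ℕ, L.Nodup ∧ (∀ x ∈ L, a ≤ x ∧ x < n) ∧
        (∀ q < a, 0 ≤ (-1 : ℝ) ^ a * stepOf q → IsZigzag stepOf ((-1) ^ (a + 1)) (q :: L)) ∧
        ∑ t ∈ Finset.Ico a (n + 1), A t ^ 2 - (L.map fun t => A t ^ 2).sum - A n ^ 2 - m / 4
          ≤ ∑ t ∈ Finset.Ico a (n + 1), errSq t := by
  intro m
  induction m using Nat.strong_induction_on with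
  | _ m ih =>
  intro a ham
  rcases Nat.lt_or_ge m 2 with hm | hm
  · refine ⟨[], by simp, by simp, fun q _ _ => trivial, ?_⟩
    obtain rfl | rfl : m = 0 ∨ m = 1 := by omega
    · obtain rfl : a = n + 1 := by omega
      simp; positivity
    · obtain rfl : a = n := by omega
      simp
      nlinarith [sq_nonneg (h a - (-1) ^ a * A a)]
  · by_cases hv : 0 ≤ (-1 : ℝ) ^ a * stepOf a
    · obtain ⟨L, h1, h2, h3, h4⟩ := ih (m - 2) (by omega) (a + 2) (by omega)
      refine ⟨L, h1, fun x hx => ⟨by have := h2 x hx; omega, (h2 x hx).2⟩, fun q hq hq0 => ?_, ?_⟩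
      · have := h3 q (by omega) (by rw [pow_add]; simpa using hq0)
        rwa [show a + 2 + 1 = a + 1 + 2 from rfl, pow_add _ (a + 1) 2, neg_one_sq, mul_one] at this
      · have := pair_error (hA a (by omega)) (hA (a + 1) (by omega)) (hstep a) hv
        rw [sum_Ico_two_add (F := fun t => A t ^ 2) (by omega),
          sum_Ico_two_add (F := fun t => errSq t) (by omega)]
        rw [Nat.cast_sub hm] at h4
        push_cast at h4
        linarith
    · obtain ⟨L, h1, h2, h3, h4⟩ := ih (m - 1) (by omega) (a + 1) (by omega)
      refine ⟨a :: L, List.nodup_cons.2 ⟨fun hmem => ?_, h1⟩, ?_, fun q hq hq0 => ?_, ?_⟩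
      · have := h2 a hmem; omega
      · intro x hx
        rcases List.mem_cons.1 hx with rfl | hx
        · omega
        · have := h2 x hx; omega
      · have := h3 a (by omega) (by rw [pow_succ]; linarith)
        refine ⟨hq, ?_, ?_⟩
        · rw [pow_succ]; linarith
        · rwa [pow_succ _ (a + 1), mul_neg_one] at this
      · rw [Finset.sum_eq_sum_Ico_succ_bot (by omega) fun t => A t ^ 2,
          Finset.sum_eq_sum_Ico_succ_bot (by omega) fun t => errSq t]
        rw [Nat.cast_sub (by omega)] at h4
        push_cast at h4
        simp only [List.map_cons, List.sum_cons]
        nlinarith [sq_nonneg (h a - (-1) ^ a * A a)]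

/-- The initial run of the greedy matching: `p` is the first position that is not matched. -/
lemma exists_first_unmatched {n : ℕ} (hA : ∀ t ≤ n, 0 ≤ A t)
    (hstep : ∀ t, |A (t + 1) - A t| ≤ 1) :
    ∀ (m a : ℕ), n + 1 = a + m →
      ∃ p, a ≤ p ∧ p ≤ n + 1 ∧ (-1 : ℝ) ^ p = (-1) ^ a ∧ (n ≤ p ∨ (-1 : ℝ) ^ p * stepOf p < 0) ∧
        (∑ t ∈ Finset.Ico a p, A t ^ 2 - ((p : ℝ) - a) / 4 ≤ ∑ t ∈ Finset.Ico a p, errSq t) ∧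
        (p = a ∨ ∃ r, p = r + 2 ∧ a ≤ r ∧ 0 ≤ (-1 : ℝ) ^ r * stepOf r ∧
          ∑ t ∈ Finset.Ico a r, A t ^ 2 - ((r : ℝ) - a) / 4
            ≤ ∑ t ∈ Finset.Ico a r, errSq t) := by
  intro m
  induction m using Nat.strong_induction_on with
  | _ m ih =>
  intro a ham
  by_cases hv : m < 2 ∨ (-1 : ℝ) ^ a * stepOf a < 0
  · exact ⟨a, le_rfl, by omega, rfl, hv.imp_left fun _ => by omega, by simp, Or.inl rfl⟩
  · push Not at hv
    obtain ⟨hm, hv⟩ := hv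
    obtain ⟨p, h1, h2, h3, h4, h5, h6⟩ := ih (m - 2) (by omega) (a + 2) (by omega)
    have hpair := pair_error (hA a (by omega)) (hA (a + 1) (by omega)) (hstep a) hv
    push_cast at h5
    refine ⟨p, by omega, h2, by rw [h3, pow_add]; simp, h4, ?_, Or.inr ?_⟩
    · rw [sum_Ico_two_add (F := fun t => A t ^ 2) (by omega),
          sum_Ico_two_add (F := fun t => errSq t) (by omega)]
      linarith
    · rcases h6 with rfl | ⟨r, hr, har, hvr, hs⟩
      · exact ⟨a, rfl, le_rfl, hv, by simp⟩
      · refine ⟨r, hr, by omega, hvr, ?_⟩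
        rw [sum_Ico_two_add (F := fun t => A t ^ 2) (by omega),
          sum_Ico_two_add (F := fun t => errSq t) (by omega)]
        push_cast at hs
        linarith

lemma sum_map_eq_sum_toFinset {L : List ℕ} (hL : L.Nodup) (F : ℕ → ℝ) :
    (L.map F).sum = ∑ t ∈ L.toFinset, F t := by
  rw [List.sum_toFinset _ hL]

/-- A sequence whose forward differences zigzag at most `d` times captures little more than
`d - 1` terms of a slowly varying concave alternating sequence. -/
theorem alternating_error {d s n : ℕ} {Y C : ℝ} (hd : 1 ≤ d) (hsn : s < n) (hA : ∀ t ≤ n, 0 ≤ A t)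
    (hstep : ∀ t, |A (t + 1) - A t| ≤ 1) (hconc : ∀ t, A t + A (t + 2) ≤ 2 * A (t + 1))
    (hY : ∀ t, A t ≤ Y) (hC : Y ^ 2 / 3 + 2 ≤ C) (hCs : (A s + 1) ^ 2 ≤ C)
    (hzig : ∀ η l, IsZigzag stepOf η l → l.length ≤ d + 1) :
    ∃ S : Finset ℕ, S ⊆ Finset.Ico s (n + 1) ∧ S.card ≤ d - 1 ∧
      ∑ t ∈ Finset.Ico s (n + 1), A t ^ 2 - ∑ t ∈ S, A t ^ 2 - A s ^ 2 - A n ^ 2 - C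
        - ((n : ℝ) + 1 - s) / 4 ≤ ∑ t ∈ Finset.Ico s (n + 1), errSq t := by
  have hC0 : 0 ≤ C := le_trans (by positivity) hCs
  -- the greedy matching starts at `a`, leaving `s` unmatched if its step is followed
  obtain ⟨a, has, han, ha_sum, ha_sign, ha_ne⟩ : ∃ a, s ≤ a ∧ a ≤ s + 1 ∧
      (∀ r, a ≤ r → ∑ t ∈ Finset.Ico s r, A t ^ 2 - A s ^ 2 ≤ ∑ t ∈ Finset.Ico a r, A t ^ 2 ∧
        ∑ t ∈ Finset.Ico a r, errSq t ≤ ∑ t ∈ Finset.Ico s r, errSq t) ∧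
      0 ≤ (-1 : ℝ) ^ a * stepOf s ∧ (a = s → 0 ≤ (-1 : ℝ) ^ s * stepOf s) := by
    by_cases hv : 0 ≤ (-1 : ℝ) ^ s * stepOf s
    · exact ⟨s, le_rfl, by omega, fun r _ => ⟨by linarith [sq_nonneg (A s)], le_rfl⟩, hv,
        fun _ => hv⟩
    · refine ⟨s + 1, by omega, le_rfl, fun r hr => ?_, by rw [pow_succ]; linarith,
        fun hh => by omega⟩
      rw [Finset.sum_eq_sum_Ico_succ_bot (show s < r by omega),
        Finset.sum_eq_sum_Ico_succ_bot (show s < r by omega) (fun t => errSq t)]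
      exact ⟨by linarith, by linarith [sq_nonneg (h s - (-1) ^ s * A s)]⟩
  obtain ⟨p, hap, hpn, hpsign, hp, hsum, hprev⟩ :=
    exists_first_unmatched (h := h) hA hstep (n + 1 - a) a (by omega)
  have hasR : (s : ℝ) ≤ a := by exact_mod_cast has
  have hpnR : (p : ℝ) ≤ n + 1 := by exact_mod_cast hpn
  have split : ∀ (F : ℕ → ℝ) (r : ℕ), s ≤ r → r ≤ n + 1 → ∑ t ∈ Finset.Ico s (n + 1), F t
      = ∑ t ∈ Finset.Ico s r, F t + ∑ t ∈ Finset.Ico r (n + 1), F t :=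
    fun F r h1 h2 => (Finset.sum_Ico_consecutive F h1 h2).symm
  by_cases hpn' : n ≤ p
  · refine ⟨∅, by simp, by simp, ?_⟩
    have h1 := ha_sum p hap
    rw [split _ p (by omega) hpn, split (fun t => errSq t) p (by omega) hpn]
    have h2 : ∑ t ∈ Finset.Ico p (n + 1), A t ^ 2 ≤ A n ^ 2 := by
      obtain rfl | rfl : p = n ∨ p = n + 1 := by omega
      · simp
      · simp; positivity
    have h3 : 0 ≤ ∑ t ∈ Finset.Ico p (n + 1), errSq t :=
      Finset.sum_nonneg fun _ _ => sq_nonneg _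
    rw [Finset.sum_empty]
    linarith
  · replace hp := hp.resolve_left hpn'
    have hsp : s < p := by
      rcases Nat.lt_or_ge s p with hlt | hge
      · exact hlt
      · obtain rfl : a = s := by omega
        obtain rfl : p = a := by omega
        linarith [ha_ne rfl]
    obtain ⟨L, hnd, hL, hLz, hLsum⟩ :=
      exists_greedy_matching (h := h) hA hstep (n - p) (p + 1) (by omega)
    rw [Nat.cast_sub (by omega)] at hLsum
    have hz : IsZigzag stepOf ((-1) ^ p) (p :: L) := by
      have := hLz p (by omega) (by rw [pow_succ]; linarith)
      rwa [show p + 1 + 1 = p + 2 from rfl, pow_add, neg_one_sq, mul_one] at this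
    have hlen : L.length + 1 ≤ d := by
      have : IsZigzag stepOf (-(-1) ^ p) (s :: p :: L) :=
        ⟨hsp, by rw [← hpsign] at ha_sign; linarith, by rwa [neg_neg]⟩
      simpa using hzig _ _ this
    have hsub : L.toFinset ⊆ Finset.Ico s (n + 1) := fun x hx => by
      have := hL x (List.mem_toFinset.1 hx)
      simp; omega
    have hcard : L.toFinset.card = L.length := List.toFinset_card_of_nodup hnd
    rw [sum_map_eq_sum_toFinset hnd] at hLsum
    have hsplitp : ∀ F : ℕ → ℝ, ∑ t ∈ Finset.Ico s (n + 1), F t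
        = ∑ t ∈ Finset.Ico s p, F t + F p + ∑ t ∈ Finset.Ico (p + 1) (n + 1), F t := fun F => by
      rw [split F p (by omega) hpn, Finset.sum_eq_sum_Ico_succ_bot (show p < n + 1 by omega)]
      ring
    have hEp := sq_nonneg (h p - (-1) ^ p * A p)
    have h1 := ha_sum p hap
    by_cases hlt : L.length + 1 < d
    · refine ⟨insert p L.toFinset, Finset.insert_subset (by simp; omega) hsub, ?_, ?_⟩
      · have := Finset.card_insert_le p L.toFinset
        omega
      · rw [Finset.sum_insert fun hmem => by
          have := hL p (List.mem_toFinset.1 hmem); omega]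
        rw [hsplitp, hsplitp fun t => errSq t]
        linarith
    · refine ⟨L.toFinset, hsub, by omega, ?_⟩
      rcases hprev with hpa | ⟨r, rfl, har, hvr, hrsum⟩
      · obtain rfl : p = s + 1 := by omega
        have hb : A (s + 1) ^ 2 ≤ (A s + 1) ^ 2 := by
          have := abs_le.1 (hstep s)
          have := hA (s + 1) (by omega)
          gcongr
          linarith
        rw [hsplitp, hsplitp fun t => errSq t]
        linarith
      · have htri : (-1 : ℝ) ^ r * ((h (r + 2) - h (r + 1)) - (h (r + 1) - h r)) ≤ 0 := by
          by_contra! hc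
          rw [pow_add, neg_one_sq, mul_one] at hz hp
          have : IsZigzag stepOf ((-1) ^ r) (r :: (r + 1) :: (r + 2) :: L) := by
            refine ⟨by omega, hc, by omega, ?_, by rwa [neg_neg]⟩
            simp only at hp hvr ⊢
            rw [show r + 1 + 1 = r + 2 from rfl]
            linarith
          have := hzig _ _ this
          simp at this
          omega
        have ht := triple_error (hA r (by omega)) (hA (r + 1) (by omega))
          (hA (r + 2) (by omega)) (hstep r) (hstep (r + 1)) (hconc r) (hY _) htri
        have h1r := ha_sum r har
        have hs3 : ∀ F : ℕ → ℝ, ∑ t ∈ Finset.Ico s (n + 1), F t = ∑ t ∈ Finset.Ico s r, F t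
            + (F r + F (r + 1) + F (r + 2)) + ∑ t ∈ Finset.Ico (r + 2 + 1) (n + 1), F t := by
          intro F
          rw [split F r (by omega) (by omega), sum_Ico_two_add (a := r) (by omega),
            Finset.sum_eq_sum_Ico_succ_bot (show r + 2 < n + 1 by omega)]
          ring
        rw [hs3, hs3 fun t => errSq t]
        push_cast at hLsum
        linarith

end Alternating
lemma sqrt_le_MRD {d : ℕ} {B : ℝ} (ρ : Equiv.Perm (Fin (d ^ 2)))
    (hB : ∀ s ∈ SMLP d,
      B ≤ ∑ j, (s (fun k => Pmat d j k) - (((ρ j : ℕ) : ℝ) + 1)) ^ 2) :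
    Real.sqrt B ≤ MRD (SMLP d) := by
  have : Nonempty (SMLP d) := ⟨⟨_, 0, 0, rfl⟩⟩
  refine le_trans ?_ (le_ciSup (Set.finite_range _).bddAbove ρ.symm)
  exact le_ciInf fun s => Real.sqrt_le_sqrt (hB s.1 s.2)

/-- The rows of `Pmat d` that do not wrap around lie on a line, along which every function of
`SMLP d` is a sum of `d` ramps. -/
lemma sqrt_le_MRD_of_ramps {d : ℕ} {B : ℝ} (hd : 2 ≤ d) (R : ℕ → ℕ)
    (hR : ∀ j < d ^ 2, R j < d ^ 2) (hinj : ∀ i < d ^ 2, ∀ j < d ^ 2, R i = R j → i = j)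
    (hB : ∀ w a b : Fin d → ℝ, B ≤ ∑ t ∈ Finset.range (d ^ 2 - d + 1),
      (∑ i, w i * max (a i * t + b i) 0 - ((R t : ℝ) + 1)) ^ 2) :
    Real.sqrt B ≤ MRD (SMLP d) := by
  let r : Fin (d ^ 2) → Fin (d ^ 2) := fun j => ⟨R j, hR j j.2⟩
  have hr : Function.Injective r := fun i j hij =>
    Fin.ext (hinj i i.2 j j.2 (by simpa [r] using hij))
  refine sqrt_le_MRD (Equiv.ofBijective r (Finite.injective_iff_bijective.1 hr)) ?_
  rintro s ⟨W, w, rfl⟩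
  refine (hB w (fun i => ∑ k, W i k) (fun i => ∑ k, W i k * ((k : ℕ) + 1 : ℝ))).trans ?_
  let E : ℕ → ℝ := fun t =>
    (∑ i, w i * max (∑ k, W i k * (((t + (k : ℕ)) % d ^ 2 + 1 : ℕ) : ℝ)) 0 - ((R t : ℝ) + 1)) ^ 2
  calc _ = ∑ t ∈ Finset.range (d ^ 2 - d + 1), E t := by
        refine Finset.sum_congr rfl fun t ht => ?_
        have htd : t + d ≤ d ^ 2 := by
          have : d ≤ d ^ 2 := by nlinarith
          simp at ht; omega
        simp only [E]
        congr 3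
        funext i
        congr 2
        rw [Finset.sum_mul, ← Finset.sum_add_distrib]
        refine Finset.sum_congr rfl fun k _ => ?_
        rw [Nat.mod_eq_of_lt (by omega)]
        push_cast
        ring
    _ ≤ ∑ t ∈ Finset.range (d ^ 2), E t := by
        refine Finset.sum_le_sum_of_subset_of_nonneg (fun t ht => ?_) fun t _ _ => sq_nonneg _
        have : d ≤ d ^ 2 := by nlinarith
        simp at ht ⊢
        omega
    _ = _ := Finset.sum_range E

/-- The ranks used on the line for `d = 3`. -/
def rankThree (t : ℕ) : ℕ := [2, 7, 1, 8, 0, 6, 3, 4, 5].getD t 0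

lemma sqrt_le_MRD_three : Real.sqrt 17 ≤ MRD (SMLP 3) := by
  refine sqrt_le_MRD_of_ramps (by norm_num) rankThree (by decide) (by decide) fun w a b => ?_
  obtain ⟨f, hf⟩ : ∃ f : ℕ → ℝ, ∀ t : ℕ, f t = ∑ i, w i * max (a i * t + b i) 0 :=
    ⟨_, fun _ => rfl⟩
  have hz : ∀ η l, IsZigzag (fun t => f (t + 1) - f t) η l → l.length ≤ 4 := by
    intro η l h
    refine IsZigzag.length_le (d := 3) w a b (η := η) ?_
    convert h using 2 with t
    rw [hf, hf, ← Finset.sum_sub_distrib]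
    exact Finset.sum_congr rfl fun i _ => by simp only [rampDiff]; push_cast; ring
  simp only [← hf]
  norm_num [Finset.sum_range_succ, rankThree]
  have p0 := sq_nonneg (f 0 - 3)
  have p1 := sq_nonneg (f 1 - 8)
  have p2 := sq_nonneg (f 2 - 2)
  have p3 := sq_nonneg (f 3 - 9)
  have p4 := sq_nonneg (f 4 - 1)
  have p5 := sq_nonneg (f 5 - 7)
  have p6 := sq_nonneg (f 6 - 4)
  by_cases h1 : f 1 ≤ f 2
  · nlinarith [sq_nonneg (f 1 - 8 + (f 2 - 2))]
  by_cases h2 : f 3 ≤ f 2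
  · nlinarith [sq_nonneg (f 2 - 2 + (f 3 - 9))]
  by_cases h3 : f 3 ≤ f 4
  · nlinarith [sq_nonneg (f 3 - 9 + (f 4 - 1))]
  by_cases h4 : f 5 ≤ f 4
  · nlinarith [sq_nonneg (f 4 - 1 + (f 5 - 7))]
  push Not at h1 h2 h3 h4
  have h0 : f 1 ≤ f 0 := by
    by_contra! h0
    have := hz (-1) [0, 1, 2, 3, 4] (by
      norm_num [IsZigzag]
      refine ⟨?_, ?_, ?_, ?_⟩ <;> linarith)
    simp at this
  have h5 : f 5 ≤ f 6 := by
    by_contra! h5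
    have := hz 1 [1, 2, 3, 4, 5] (by
      norm_num [IsZigzag]
      refine ⟨?_, ?_, ?_, ?_⟩ <;> linarith)
    simp at this
  nlinarith [sq_nonneg (f 0 - 3 + (f 1 - 8)), sq_nonneg (f 5 - 7 + (f 6 - 4))]

lemma second_diff_relu_nonneg (a b : ℝ) :
    0 ≤ max (a + 2 * b) 0 - 2 * max (2 * a + 3 * b) 0 + max (3 * a + 4 * b) 0 := by
  have h1 := le_max_left (a + 2 * b) 0
  have h2 := le_max_right (a + 2 * b) 0
  have h3 := le_max_left (3 * a + 4 * b) 0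
  have h4 := le_max_right (3 * a + 4 * b) 0
  rcases max_cases (2 * a + 3 * b) 0 with h | h <;> linarith

lemma wrap_relation_relu_nonneg (a b : ℝ) :
    0 ≤ 13 * max (2 * a + 3 * b) 0 - 10 * max (3 * a + 4 * b) 0 + max (4 * a + b) 0 := by
  have h1 := le_max_left (2 * a + 3 * b) 0
  have h2 := le_max_right (2 * a + 3 * b) 0
  have h3 := le_max_left (4 * a + b) 0
  have h4 := le_max_right (4 * a + b) 0
  rcases max_cases (3 * a + 4 * b) 0 with h | h <;> linarith

lemma wrap_relation_relu_cases (a b : ℝ) :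
    13 * max (2 * a + 3 * b) 0 - 10 * max (3 * a + 4 * b) 0 + max (4 * a + b) 0 = 0 ∨
      max (a + 2 * b) 0 = 0 ∨ max (4 * a + b) 0 = 0 := by
  by_cases h1 : a + 2 * b ≤ 0
  · exact Or.inr (Or.inl (max_eq_right h1))
  by_cases h4 : 4 * a + b ≤ 0
  · exact Or.inr (Or.inr (max_eq_right h4))
  push Not at h1 h4
  left
  rw [max_eq_left (by linarith), max_eq_left (by linarith), max_eq_left (by linarith)]
  ring

/-- The ranks `1, 4, 2, 3` are far from every vector of values satisfying one of these relations. -/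
lemma half_le_error {f₁ f₂ f₃ f₄ : ℝ} (h : 0 ≤ f₁ - 2 * f₂ + f₃ ∨ 13 * f₂ - 10 * f₃ + f₄ ≤ 0 ∨
    f₁ ≤ 0 ∨ f₄ ≤ 0) :
    1 / 2 ≤ (f₁ - 1) ^ 2 + (f₂ - 4) ^ 2 + (f₃ - 2) ^ 2 + (f₄ - 3) ^ 2 := by
  have p1 := sq_nonneg (f₁ - 1)
  have p2 := sq_nonneg (f₂ - 4)
  have p3 := sq_nonneg (f₃ - 2)
  have p4 := sq_nonneg (f₄ - 3)
  rcases h with h | h | h | h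
  · nlinarith [sq_nonneg (f₁ - 1 - 5 / 6), sq_nonneg (f₂ - 4 + 5 / 3), sq_nonneg (f₃ - 2 - 5 / 6)]
  · nlinarith [sq_nonneg (f₂ - 4 + 35 * 13 / 270), sq_nonneg (f₃ - 2 - 35 * 10 / 270),
      sq_nonneg (f₄ - 3 + 35 / 270)]
  · nlinarith
  · nlinarith

lemma half_le_error_two_relus (a b u v p q : ℝ) :
    1 / 2 ≤ (p * max (a + 2 * b) 0 + q * max (u + 2 * v) 0 - 1) ^ 2
      + (p * max (2 * a + 3 * b) 0 + q * max (2 * u + 3 * v) 0 - 4) ^ 2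
      + (p * max (3 * a + 4 * b) 0 + q * max (3 * u + 4 * v) 0 - 2) ^ 2
      + (p * max (4 * a + b) 0 + q * max (4 * u + v) 0 - 3) ^ 2 := by
  wlog hpq : q ≤ p generalizing a b u v p q
  · have := this u v a b q p (by linarith)
    simpa only [add_comm] using this
  apply half_le_error
  have A := second_diff_relu_nonneg a b
  have A' := second_diff_relu_nonneg u v
  have B := wrap_relation_relu_nonneg a b
  have B' := wrap_relation_relu_nonneg u v
  have C := wrap_relation_relu_cases a b
  have n1 := le_max_right (u + 2 * v) 0
  have n4 := le_max_right (4 * u + v) 0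
  generalize max (a + 2 * b) 0 = r₁, max (2 * a + 3 * b) 0 = r₂, max (3 * a + 4 * b) 0 = r₃,
    max (4 * a + b) 0 = r₄, max (u + 2 * v) 0 = t₁, max (2 * u + 3 * v) 0 = t₂,
    max (3 * u + 4 * v) 0 = t₃, max (4 * u + v) 0 = t₄ at *
  rcases le_total 0 q with hq | hq
  · left
    nlinarith [mul_nonneg (hq.trans hpq) A, mul_nonneg hq A']
  right
  rcases le_total p 0 with hp | hp
  · left
    nlinarith [mul_nonpos_of_nonpos_of_nonneg hp B, mul_nonpos_of_nonpos_of_nonneg hq B']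
  rcases C with C | C | C
  · left
    nlinarith [congrArg (p * ·) C, mul_nonpos_of_nonpos_of_nonneg hq B']
  · right; left
    rw [C]; nlinarith
  · right; right
    rw [C]; nlinarith

lemma sqrt_le_MRD_two : Real.sqrt (1 / 2) ≤ MRD (SMLP 2) := by
  refine sqrt_le_MRD (Equiv.ofBijective (![0, 3, 1, 2] : Fin (2 ^ 2) → Fin (2 ^ 2))
    (by decide)) ?_
  rintro s ⟨W, w, rfl⟩
  have hsum : ∀ F : Fin (2 ^ 2) → ℝ, ∑ j, F j = F 0 + F 1 + F 2 + F 3 := fun F =>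
    Fin.sum_univ_four F
  refine (half_le_error_two_relus (W 0 0) (W 0 1) (W 1 0) (W 1 1) (w 0) (w 1)).trans_eq ?_
  have e₂ : ((![0, 3, 1, 2] : Fin (2 ^ 2) → Fin (2 ^ 2)) 2 : ℕ) = 1 := rfl
  have e₃ : ((![0, 3, 1, 2] : Fin (2 ^ 2) → Fin (2 ^ 2)) 3 : ℕ) = 2 := rfl
  rw [hsum]
  simp only [Fin.sum_univ_two, Equiv.ofBijective_apply, Pmat, e₂, e₃]
  norm_num
  ring_nf

/-- Removing `q - p` terms from a sum removes at most the `q - p` largest terms. -/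
lemma sum_Ico_add_sum_Ico_le {F : ℕ → ℝ} {θ : ℝ} {s p q n : ℕ} {S : Finset ℕ} (hsp : s ≤ p)
    (hpq : p ≤ q) (hqn : q ≤ n) (hS : S ⊆ Finset.Ico s n) (hcard : S.card ≤ q - p) (hθ : 0 ≤ θ)
    (hin : ∀ t, p ≤ t → t < q → θ ≤ F t) (hleft : ∀ t, t < p → s ≤ t → F t ≤ θ)
    (hright : ∀ t, q ≤ t → t < n → F t ≤ θ) :
    ∑ t ∈ Finset.Ico s p, F t + ∑ t ∈ Finset.Ico q n, F t
      ≤ ∑ t ∈ Finset.Ico s n, F t - ∑ t ∈ S, F t := by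
  rw [← Finset.sum_Ico_consecutive F hsp (hpq.trans hqn), ← Finset.sum_Ico_consecutive F hpq hqn]
  have h1 : ∑ t ∈ S, (F t - θ) ≤ ∑ t ∈ Finset.Ico p q, (F t - θ) := by
    rw [← Finset.sum_inter_add_sum_sdiff S (Finset.Ico p q)]
    have h2 : ∑ t ∈ S \ Finset.Ico p q, (F t - θ) ≤ 0 := by
      refine Finset.sum_nonpos fun t ht => sub_nonpos.2 ?_
      rw [Finset.mem_sdiff, Finset.mem_Ico] at ht
      have := Finset.mem_Ico.1 (hS ht.1)
      by_cases htp : t < p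
      · exact hleft t htp this.1
      · exact hright t (by omega) this.2
    have h3 : ∑ t ∈ S ∩ Finset.Ico p q, (F t - θ) ≤ ∑ t ∈ Finset.Ico p q, (F t - θ) := by
      refine Finset.sum_le_sum_of_subset_of_nonneg Finset.inter_subset_right fun t ht _ => ?_
      have := Finset.mem_Ico.1 ht
      exact sub_nonneg.2 (hin t this.1 this.2)
    linarith
  simp only [Finset.sum_sub_distrib, Finset.sum_const, Nat.card_Ico, nsmul_eq_mul] at h1
  have h4 : (S.card : ℝ) * θ ≤ ((q - p : ℕ) : ℝ) * θ := by gcongr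
  linarith

/-- The polynomial with forward difference `x ^ 2`. -/
def sqAntidiff (x : ℝ) : ℝ := x * (x - 1) * (2 * x - 1) / 6

lemma sum_Ico_add_sq (c : ℝ) {a b : ℕ} (hab : a ≤ b) :
    ∑ t ∈ Finset.Ico a b, ((t : ℝ) + c) ^ 2 = sqAntidiff (b + c) - sqAntidiff (a + c) := by
  induction b, hab using Nat.le_induction with
  | base => simp
  | succ b hab ih =>
    rw [Finset.sum_Ico_succ_top hab, ih]
    simp only [sqAntidiff]
    push_cast
    ring

/-- The ranks for which the centered ranks alternate in sign, with a tent of absolute values. -/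
def tentRank (N u : ℕ) : ℕ :=
  if 2 * u + (1 - N % 2) ≤ N then
    if u % 2 = 0 then N / 2 + u else N / 2 - (1 - N % 2) - u
  else
    if u % 2 = 0 then N + N / 2 - (1 - N % 2) - u else N / 2 + u - N

/-- The absolute values of the centered ranks `tentRank N`. -/
def tent (N u : ℕ) : ℝ :=
  min ((u : ℝ) + ((1 - N % 2 : ℕ) : ℝ) / 2) (N - u - ((1 - N % 2 : ℕ) : ℝ) / 2)

lemma tentRank_lt {N u : ℕ} (hu : u < N) : tentRank N u < N := by
  unfold tentRank
  split_ifs <;> omega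

lemma tentRank_injOn {N u v : ℕ} (hu : u < N) (hv : v < N) (h : tentRank N u = tentRank N v) :
    u = v := by
  unfold tentRank at h
  split_ifs at h <;> omega

lemma tentRank_sub {N u : ℕ} (hu : u < N) :
    (tentRank N u : ℝ) + 1 - (N + 1) / 2 = (-1) ^ u * tent N u := by
  have key : ∀ x : ℤ, ((tentRank N u : ℤ) * 2 - N + 1 = x) →
      (tentRank N u : ℝ) + 1 - (N + 1) / 2 = x / 2 := by
    rintro x rfl
    push_cast
    ring
  obtain ⟨e, he⟩ : ∃ e, e = 1 - N % 2 := ⟨_, rfl⟩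
  rw [tent, ← he]
  rcases le_or_gt (2 * u + e) N with hl | hl
  · have hlR : 2 * (u : ℝ) + e ≤ N := by exact_mod_cast hl
    rw [min_eq_left (by linarith)]
    rcases Nat.even_or_odd u with hp | hp
    · rw [hp.neg_one_pow, key (2 * u + e)]
      · push_cast; ring
      · rw [Nat.even_iff] at hp
        rw [tentRank, ← he, if_pos hl, if_pos hp]
        omega
    · rw [hp.neg_one_pow, key (-(2 * u + e))]
      · push_cast; ring
      · rw [Nat.odd_iff] at hp
        rw [tentRank, ← he, if_pos hl, if_neg (by omega)]
        omega
  · have hlR : (N : ℝ) < 2 * (u : ℝ) + e := by exact_mod_cast hl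
    rw [min_eq_right (by linarith)]
    rcases Nat.even_or_odd u with hp | hp
    · rw [hp.neg_one_pow, key (2 * N - 2 * u - e)]
      · push_cast; ring
      · rw [Nat.even_iff] at hp
        rw [tentRank, ← he, if_neg (by omega), if_pos hp]
        omega
    · rw [hp.neg_one_pow, key (-(2 * N - 2 * u - e))]
      · push_cast; ring
      · rw [Nat.odd_iff] at hp
        rw [tentRank, ← he, if_neg (by omega), if_neg (by omega)]
        omega

lemma tent_succ_sub_abs_le (N u : ℕ) : |tent N (u + 1) - tent N u| ≤ 1 := by
  refine (abs_min_sub_min_le_max _ _ _ _).trans (max_le ?_ ?_) <;> rw [abs_le] <;>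
    constructor <;> push_cast <;> linarith

lemma tent_concave (N u : ℕ) : tent N u + tent N (u + 2) ≤ 2 * tent N (u + 1) := by
  have h1 := min_le_left ((u : ℝ) + ((1 - N % 2 : ℕ) : ℝ) / 2) (N - u - ((1 - N % 2 : ℕ) : ℝ) / 2)
  have h2 := min_le_right ((u : ℝ) + ((1 - N % 2 : ℕ) : ℝ) / 2) (N - u - ((1 - N % 2 : ℕ) : ℝ) / 2)
  have h3 := min_le_left (((u + 2 : ℕ) : ℝ) + ((1 - N % 2 : ℕ) : ℝ) / 2)
    (N - (u + 2 : ℕ) - ((1 - N % 2 : ℕ) : ℝ) / 2)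
  have h4 := min_le_right (((u + 2 : ℕ) : ℝ) + ((1 - N % 2 : ℕ) : ℝ) / 2)
    (N - (u + 2 : ℕ) - ((1 - N % 2 : ℕ) : ℝ) / 2)
  simp only [tent]
  rcases min_choice (((u + 1 : ℕ) : ℝ) + ((1 - N % 2 : ℕ) : ℝ) / 2)
    (N - (u + 1 : ℕ) - ((1 - N % 2 : ℕ) : ℝ) / 2) with h | h <;> rw [h] <;>
  push_cast at * <;> linarith

lemma sqrt_le_MRD_of_tent {d N s n p q e : ℕ} {B : ℝ} (hd : 2 ≤ d) (hN : N = d ^ 2)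
    (he : e = 1 - N % 2) (hsd : s < d) (hn : n + d = N + s) (hpq : q = p + (d - 1)) (hsp : s ≤ p)
    (hqn : q ≤ n) (hp : 2 * p + e ≤ N + 2) (hq : N ≤ 2 * q + e) (hlo : N ≤ p + q + e)
    (hhi : p + q + e ≤ N + 1) (hs : ((s : ℝ) + e / 2 + 1) ^ 2 ≤ (N : ℝ) ^ 2 / 12 + 2)
    (hB : B ≤ (sqAntidiff (p + e / 2) - sqAntidiff (s + e / 2))
      + (sqAntidiff (n + 1 + (e / 2 - N)) - sqAntidiff (q + (e / 2 - N)))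
      - (s + e / 2) ^ 2 - (N - n - e / 2) ^ 2 - ((N : ℝ) ^ 2 / 12 + 2) - ((n : ℝ) + 1 - s) / 4) :
    Real.sqrt B ≤ MRD (SMLP d) := by
  have hsn : s < n := by omega
  have hdN : d < N := by subst hN; nlinarith
  have hs_add : ∀ j < N, (if j + s < N then j + s else j + s - N) < N := fun j hj => by
    split_ifs <;> omega
  refine sqrt_le_MRD_of_ramps hd
    (fun j => tentRank N (if j + s < N then j + s else j + s - N)) ?_ ?_ ?_
  · rw [← hN]
    exact fun j hj => tentRank_lt (hs_add j hj)
  · rw [← hN]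
    intro i hi j hj hij
    have := tentRank_injOn (hs_add i hi) (hs_add j hj) hij
    split_ifs at this <;> omega
  intro w a b
  let h : ℕ → ℝ := fun u => ∑ i, w i * max (a i * u + (b i - a i * s)) 0 - ((N : ℝ) + 1) / 2
  have hstep : (fun t => h (t + 1) - h t)
      = fun t => ∑ i, w i * rampDiff (a i) (b i - a i * s) t := by
    funext t
    simp only [h, sub_sub_sub_cancel_right, rampDiff, ← Finset.sum_sub_distrib, ← mul_sub]
    push_cast
    rfl
  have hl : ∀ u, tent N u ≤ u + (e : ℝ) / 2 := fun u => by rw [he]; exact min_le_left _ _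
  have hr : ∀ u, tent N u ≤ N - u - (e : ℝ) / 2 := fun u => by rw [he]; exact min_le_right _ _
  have he1 : e ≤ 1 := by omega
  have he1R : (e : ℝ) ≤ 1 := by exact_mod_cast he1
  have hpos : ∀ t ≤ n, 0 ≤ tent N t := fun t ht => by
    have : (t : ℝ) + 1 ≤ N := by exact_mod_cast (by omega : t + 1 ≤ N)
    rw [tent, ← he]
    exact le_min (by positivity) (by linarith)
  have hin : ∀ t, p ≤ t → t < q → (p : ℝ) + e / 2 ≤ tent N t := fun t h1 h2 => by
    have h1R : (p : ℝ) ≤ t := by exact_mod_cast h1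
    have h2R : (t : ℝ) + 1 ≤ q := by exact_mod_cast h2
    have hhiR : (p : ℝ) + q + e ≤ N + 1 := by exact_mod_cast hhi
    rw [tent, ← he]
    exact le_min (by linarith) (by linarith)
  have hloR : (N : ℝ) ≤ p + q + e := by exact_mod_cast hlo
  obtain ⟨S, hS, hcard, hsum⟩ := alternating_error (h := h) (A := tent N) (d := d) (s := s)
    (n := n) (Y := N / 2) (C := (N : ℝ) ^ 2 / 12 + 2) (by omega) hsn hpos
    (tent_succ_sub_abs_le N) (tent_concave N) (fun t => by linarith [hl t, hr t])
    (by linarith) (le_trans (by have := hpos s hsn.le; gcongr; exact hl s) hs) (by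
      rw [hstep]
      exact fun η l hz => hz.length_le)
  have hsq : ∀ {x y : ℝ}, 0 ≤ x → x ≤ y → x ^ 2 ≤ y ^ 2 := fun hx hxy => by gcongr
  have hcap := sum_Ico_add_sum_Ico_le (F := fun t => tent N t ^ 2) (θ := ((p : ℝ) + e / 2) ^ 2)
    (p := p) (q := q) hsp (by omega) (by omega) hS (by omega) (by positivity)
    (fun t h1 h2 => hsq (by positivity) (hin t h1 h2))
    (fun t h1 h2 => hsq (hpos t (by omega)) ((hl t).trans (by
      have : (t : ℝ) ≤ p := by exact_mod_cast h1.le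
      linarith)))
    (fun t h1 h2 => hsq (hpos t (by omega)) ((hr t).trans (by
      have : (q : ℝ) ≤ t := by exact_mod_cast h1
      linarith)))
  have hleft : ∑ t ∈ Finset.Ico s p, tent N t ^ 2
      = sqAntidiff (p + e / 2) - sqAntidiff (s + e / 2) := by
    rw [← sum_Ico_add_sq _ hsp]
    refine Finset.sum_congr rfl fun t ht => ?_
    have htp := (Finset.mem_Ico.1 ht).2
    have : 2 * (t : ℝ) + e ≤ N := by exact_mod_cast (by omega : 2 * t + e ≤ N)
    rw [tent, ← he, min_eq_left (by linarith)]
  have hright : ∑ t ∈ Finset.Ico q (n + 1), tent N t ^ 2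
      = sqAntidiff (n + 1 + (e / 2 - N)) - sqAntidiff (q + (e / 2 - N)) := by
    have := sum_Ico_add_sq ((e : ℝ) / 2 - N) (show q ≤ n + 1 by omega)
    push_cast at this
    rw [← this]
    refine Finset.sum_congr rfl fun t ht => ?_
    have htq := (Finset.mem_Ico.1 ht).1
    have : (N : ℝ) ≤ 2 * t + e := by exact_mod_cast (by omega : N ≤ 2 * t + e)
    rw [tent, ← he, min_eq_right (by linarith)]
    ring
  have hends := hsq (hpos s hsn.le) (hl s)
  have hendn := hsq (hpos n le_rfl) (hr n)
  have htotal : ∑ t ∈ Finset.Ico s (n + 1), (h t - (-1) ^ t * tent N t) ^ 2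
      = ∑ t ∈ Finset.range (d ^ 2 - d + 1), (∑ i, w i * max (a i * t + b i) 0
        - ((tentRank N (if t + s < N then t + s else t + s - N) : ℝ) + 1)) ^ 2 := by
    rw [Finset.sum_Ico_eq_sum_range, ← hN, show n + 1 - s = N - d + 1 by omega]
    refine Finset.sum_congr rfl fun t ht => ?_
    have hts : t + s < N := by
      have := Finset.mem_range.1 ht
      omega
    rw [if_pos hts, add_comm s t, ← tentRank_sub hts]
    congr 1
    simp only [h]
    rw [show ∀ x y z : ℝ, x - z - (y + 1 - z) = x - (y + 1) from fun x y z => by ring]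
    congr 2
    funext i
    push_cast
    ring_nf
  rw [← htotal]
  linarith

lemma sqrt_le_MRD_even {m : ℕ} (hm : 2 ≤ m) {B : ℝ}
    (hB : B ≤ ((((2 * m : ℕ) : ℝ) ^ 2 - (2 * m : ℕ)) ^ 3 - (((2 * m : ℕ) : ℝ) ^ 2 - (2 * m : ℕ)) -
        (((2 * m : ℕ) : ℝ) ^ 3 - 3 * ((2 * m : ℕ) : ℝ) ^ 2 + 2 * ((2 * m : ℕ) : ℝ))) / 12) :
    Real.sqrt B ≤ MRD (SMLP (2 * m)) := by
  obtain ⟨k, rfl⟩ := Nat.exists_eq_add_of_le' hm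
  refine sqrt_le_MRD_of_tent (N := (2 * (k + 2)) ^ 2) (s := k + 2) (e := 1)
    (n := 4 * k ^ 2 + 15 * k + 14) (p := 2 * k ^ 2 + 7 * k + 6) (q := 2 * k ^ 2 + 9 * k + 9)
    (by omega) rfl ?_ (by omega) (by ring) (by omega) ?_ ?_ ?_ ?_ ?_ ?_ ?_ (hB.trans ?_)
  · ring_nf; omega
  any_goals nlinarith
  · push_cast
    nlinarith [show (0 : ℝ) ≤ k from Nat.cast_nonneg k, show (0 : ℝ) ≤ (k : ℝ) ^ 2 by positivity,
      show (0 : ℝ) ≤ (k : ℝ) ^ 3 by positivity, show (0 : ℝ) ≤ (k : ℝ) ^ 4 by positivity]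
  · rw [← sub_nonneg]
    simp only [sqAntidiff]
    push_cast
    ring_nf
    positivity

lemma sqrt_le_MRD_odd {m : ℕ} (hm : 2 ≤ m) {B : ℝ}
    (hB : B ≤ ((((2 * m + 1 : ℕ) : ℝ) ^ 2 - (2 * m + 1 : ℕ)) ^ 3
        - (((2 * m + 1 : ℕ) : ℝ) ^ 2 - (2 * m + 1 : ℕ)) - (((2 * m + 1 : ℕ) : ℝ) ^ 3
          - 3 * ((2 * m + 1 : ℕ) : ℝ) ^ 2 + 2 * ((2 * m + 1 : ℕ) : ℝ))) / 12) :
    Real.sqrt B ≤ MRD (SMLP (2 * m + 1)) := by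
  obtain ⟨k, rfl⟩ := Nat.exists_eq_add_of_le' hm
  refine sqrt_le_MRD_of_tent (N := (2 * (k + 2) + 1) ^ 2) (s := k + 2) (e := 0)
    (n := 4 * k ^ 2 + 19 * k + 22) (p := 2 * k ^ 2 + 9 * k + 11) (q := 2 * k ^ 2 + 11 * k + 15)
    (by omega) rfl ?_ (by omega) (by ring) (by omega) ?_ ?_ ?_ ?_ ?_ ?_ ?_ (hB.trans ?_)
  · ring_nf; omega
  any_goals nlinarith
  · push_cast
    nlinarith [show (0 : ℝ) ≤ k from Nat.cast_nonneg k, show (0 : ℝ) ≤ (k : ℝ) ^ 2 by positivity,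
      show (0 : ℝ) ≤ (k : ℝ) ^ 3 by positivity, show (0 : ℝ) ≤ (k : ℝ) ^ 4 by positivity]
  · rw [← sub_nonneg]
    simp only [sqAntidiff]
    push_cast
    ring_nf
    positivity

/-- MRD of MLP-based attention, lower bound:
`MRD(S_MLP, P) ≥ sqrt(((N−d)³ − (N−d) − λ)/12)` where `N = d²`, `λ = d³ − 3d² + 2d`. -/
theorem mrd_mlp_lower_bound (d : ℕ) (hd : 2 ≤ d) :
    Real.sqrt ((((d : ℝ) ^ 2 - d) ^ 3 - ((d : ℝ) ^ 2 - d) -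
        ((d : ℝ) ^ 3 - 3 * (d : ℝ) ^ 2 + 2 * (d : ℝ))) / 12)
      ≤ MRD (SMLP d) := by
  obtain rfl | rfl | hd4 : d = 2 ∨ d = 3 ∨ 4 ≤ d := by omega
  · convert sqrt_le_MRD_two using 2
    norm_num
  · convert sqrt_le_MRD_three using 2
    norm_num
  · obtain ⟨m, rfl | rfl⟩ := Nat.even_or_odd' d
    · exact sqrt_le_MRD_even (by omega) le_rfl
    · exact sqrt_le_MRD_odd (by omega) le_rfl

end
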